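/- There exist a separable metrizable topological space Y and subsets X_n ⊆ Y (n ∈ ℕ) such that: each X_n is closed in Y; each X_n with its subspace topology is homeomorphic to complete Erdős space 𝔈_c; each X_n is a nowhere dense subset of the subspace X_{n+1} (in particular X_n ⊆ X_{n+1}); Y = ⋃_{n} X_n; and Y is NOT homeomorphic to ℚ × 𝔈_c. -/

import Mathlib

/- Complete Erdős space 𝔈_c, realized inside the real Hilbert space ℓ². -/

noncomputable section
open Topology Filter TopologicalSpace

/-- The set of points of ℓ² all of whose coordinates lie in {0} ∪ {1/(m+1) : m ∈ ℕ}. -/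
def ErdosSet : Set (lp (fun _ : ℕ => ℝ) 2) :=
  {x | ∀ n : ℕ, x n = 0 ∨ ∃ m : ℕ, x n = 1 / (m + 1)}

/-- Complete Erdős space 𝔈_c, with the subspace (norm) topology from ℓ². -/
abbrev Ec := ↥ErdosSet

/-- The σ-product σ𝔈_c ⊆ 𝔈_c^ω : sequences which are the zero point of 𝔈_c in all but
finitely many coordinates, with the subspace topology from the product 𝔈_c^ω. -/
def sigmaErdos : Set (ℕ → Ec) :=
  {y | {n : ℕ | (y n : lp (fun _ : ℕ => ℝ) 2) ≠ 0}.Finite}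

/-- The real Hilbert space `ℓ²`. -/
abbrev EllTwo := lp (fun _ : ℕ => ℝ) 2

namespace EllTwo

lemma summable_sq (x : EllTwo) : Summable fun n => x n ^ 2 := by
  simpa using (memℓp_gen_iff (by simp)).1 (lp.memℓp x)

lemma norm_sq_eq_tsum (x : EllTwo) : ‖x‖ ^ 2 = ∑' n, x n ^ 2 := by
  simpa using lp.norm_rpow_eq_tsum (p := 2) (by simp) x

lemma memℓp_of_summable_sq {f : ℕ → ℝ} (hf : Summable fun n => f n ^ 2) :
    Memℓp (E := fun _ : ℕ => ℝ) f 2 :=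
  memℓp_gen (by simpa using hf)

lemma tendsto_coord (x : EllTwo) : Tendsto (fun n => x n) atTop (𝓝 0) := by
  have h := (summable_sq x).tendsto_atTop_zero
  rw [tendsto_zero_iff_abs_tendsto_zero]
  simpa [Function.comp_def, Real.sqrt_sq_eq_abs] using (Real.continuous_sqrt.tendsto _).comp h

lemma abs_coord_le (x : EllTwo) (n : ℕ) : |x n| ≤ ‖x‖ := lp.norm_apply_le_norm (by simp) x n

lemma continuous_coord (n : ℕ) : Continuous fun x : EllTwo => x n := by
  refine LipschitzWith.continuous (K := 1) (LipschitzWith.of_dist_le_mul fun x y => ?_)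
  simpa [dist_eq_norm] using abs_coord_le (x - y) n

/-- Composition of a square-summable sequence with an injection. -/
def reindex (e : ℕ → ℕ) (he : Function.Injective e) (x : EllTwo) : EllTwo :=
  ⟨fun n => x (e n), memℓp_of_summable_sq ((summable_sq x).comp_injective he)⟩

@[simp] lemma reindex_apply (e : ℕ → ℕ) (he : Function.Injective e) (x : EllTwo) (n : ℕ) :
    reindex e he x n = x (e n) := rfl

lemma continuous_reindex (e : ℕ → ℕ) (he : Function.Injective e) :
    Continuous (reindex e he) := by
  have hle (x : EllTwo) : ‖reindex e he x‖ ≤ ‖x‖ := by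
    refine le_of_sq_le_sq ?_ (norm_nonneg _)
    rw [norm_sq_eq_tsum, norm_sq_eq_tsum]
    exact tsum_comp_le_tsum_of_inj (summable_sq x) (fun n => sq_nonneg _) he
  refine LipschitzWith.continuous (K := 1) (LipschitzWith.of_dist_le_mul fun x y => ?_)
  simpa [dist_eq_norm] using! hle (x - y)

lemma extend_sq (e : ℕ → ℕ) (x : ℕ → ℝ) :
    (fun n => Function.extend e x 0 n ^ 2) = Function.extend e (fun n => x n ^ 2) 0 := by
  classical
  ext n
  simp only [Function.extend_def]
  split_ifs <;> simp

/-- Extension by zero of a square-summable sequence along an injection. -/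
def extendZero (e : ℕ → ℕ) (he : Function.Injective e) (x : EllTwo) : EllTwo :=
  ⟨Function.extend e x 0, memℓp_of_summable_sq (by
    rw [extend_sq]
    exact (summable_extend_zero he).2 (summable_sq x))⟩

lemma extendZero_coe (e : ℕ → ℕ) (he : Function.Injective e) (x : EllTwo) :
    ⇑(extendZero e he x) = Function.extend e x 0 := rfl

@[simp] lemma extendZero_apply (e : ℕ → ℕ) (he : Function.Injective e) (x : EllTwo) (n : ℕ) :
    extendZero e he x (e n) = x n := by
  rw [extendZero_coe, he.extend_apply]

lemma extendZero_apply_of_notMem (e : ℕ → ℕ) (he : Function.Injective e) (x : EllTwo) {n : ℕ}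
    (hn : n ∉ Set.range e) : extendZero e he x n = 0 := by
  rw [extendZero_coe, Function.extend_apply' _ _ _ (by simpa using hn)]
  rfl

lemma continuous_extendZero (e : ℕ → ℕ) (he : Function.Injective e) :
    Continuous (extendZero e he) := by
  have hnorm (x : EllTwo) : ‖extendZero e he x‖ = ‖x‖ := by
    refine (sq_eq_sq₀ (norm_nonneg _) (norm_nonneg _)).1 ?_
    rw [norm_sq_eq_tsum, norm_sq_eq_tsum, extendZero_coe, extend_sq, tsum_extend_zero he]
  have hsub (x y : EllTwo) : extendZero e he x - extendZero e he y = extendZero e he (x - y) := by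
    ext n
    by_cases hn : n ∈ Set.range e
    · obtain ⟨m, rfl⟩ := hn
      simp
    · simp [extendZero_apply_of_notMem e he _ hn]
  refine LipschitzWith.continuous (K := 1) (LipschitzWith.of_dist_le_mul fun x y => ?_)
  simp [dist_eq_norm, hsub, hnorm]

lemma norm_sub_sq_le {x y : EllTwo} (h0 : ∀ n, 0 ≤ x n) (h : ∀ n, x n ≤ y n) :
    ‖y - x‖ ^ 2 ≤ ‖y‖ ^ 2 - ‖x‖ ^ 2 := by
  have hinner : 0 ≤ inner ℝ (y - x) x := by
    rw [lp.inner_eq_tsum]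
    refine tsum_nonneg fun n => ?_
    simpa using mul_nonneg (h0 n) (sub_nonneg.2 (h n))
  rw [inner_sub_left, real_inner_self_eq_norm_sq] at hinner
  rw [norm_sub_sq_real]
  linarith

lemma norm_le_norm {x y : EllTwo} (h0 : ∀ n, 0 ≤ x n) (h : ∀ n, x n ≤ y n) : ‖x‖ ≤ ‖y‖ := by
  refine le_of_sq_le_sq ?_ (norm_nonneg _)
  nlinarith [norm_sub_sq_le h0 h, sq_nonneg ‖y - x‖]

instance : SeparableSpace EllTwo := by
  let D : Set EllTwo := Set.range fun n => lp.single 2 n (1 : ℝ)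
  have hD : IsSeparable (closure (Submodule.span ℝ D : Set EllTwo)) :=
    ((Set.countable_range _).isSeparable.span (R := ℝ)).closure
  refine isSeparable_univ_iff.1 (hD.mono fun x _ => ?_)
  refine mem_closure_of_tendsto (lp.hasSum_single (by simp) x) (Eventually.of_forall fun s => ?_)
  refine Submodule.sum_mem _ fun n _ => ?_
  have : lp.single 2 n (x n) = x n • lp.single (E := fun _ : ℕ => ℝ) 2 n (1 : ℝ) := by
    rw [← lp.single_smul]; simp
  rw [this]
  exact Submodule.smul_mem _ _ (Submodule.subset_span ⟨n, rfl⟩)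

instance : SecondCountableTopology EllTwo := UniformSpace.secondCountable_of_separable _

end EllTwo

/-- The set `{0} ∪ {1/(m+1) : m ∈ ℕ}` of possible coordinates of points of `Ec`. -/
def ErdosValues : Set ℝ := {t | t = 0 ∨ ∃ m : ℕ, t = 1 / (m + 1)}

namespace ErdosValues

lemma zero_mem : (0 : ℝ) ∈ ErdosValues := Or.inl rfl

lemma one_mem : (1 : ℝ) ∈ ErdosValues := Or.inr ⟨0, by simp⟩

lemma inv_mem (m : ℕ) : (1 / (m + 1) : ℝ) ∈ ErdosValues := Or.inr ⟨m, rfl⟩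

lemma nonneg {t : ℝ} (ht : t ∈ ErdosValues) : 0 ≤ t := by
  rcases ht with rfl | ⟨m, rfl⟩
  · exact le_rfl
  · positivity

lemma isCompact : IsCompact ErdosValues := by
  have h := (tendsto_one_div_add_atTop_nhds_zero_nat (𝕜 := ℝ)).isCompact_insert_range
  convert h using 1
  ext t
  simp only [ErdosValues, Set.mem_ofPred_eq, Set.mem_insert_iff, Set.mem_range, eq_comm]

instance : CompactSpace ErdosValues := isCompact_iff_compactSpace.1 isCompact

lemma exists_gt {ε t : ℝ} (ht : t ∈ ErdosValues) (hε : t < ε) (h1 : t < 1) :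
    ∃ v ∈ ErdosValues, t < v ∧ v - t < ε := by
  rcases ht with rfl | ⟨m, rfl⟩
  · obtain ⟨m, hm⟩ := exists_nat_one_div_lt hε
    exact ⟨_, inv_mem m, by positivity, by simpa using hm⟩
  · rcases m with _ | m
    · simp at h1
    refine ⟨_, inv_mem m, one_div_lt_one_div_of_lt (by positivity) (by simp), ?_⟩
    refine lt_of_le_of_lt ?_ hε
    push_cast
    have hm : (0 : ℝ) < m + 1 := by positivity
    have hm' : (0 : ℝ) < m + 1 + 1 := by positivity
    rw [sub_le_iff_le_add, ← add_div, div_le_div_iff₀ hm hm']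
    linarith [(Nat.cast_nonneg m : (0 : ℝ) ≤ m)]

/-- Adjoining an isolated point to `ErdosValues`. -/
def unitSum : Unit ⊕ ErdosValues → ErdosValues :=
  Sum.elim (fun _ => ⟨1, one_mem⟩) fun t => ⟨t / (1 + t), by
    rcases t with ⟨t, rfl | ⟨m, rfl⟩⟩
    · simpa using zero_mem
    · convert inv_mem (m + 1) using 1
      push_cast
      field_simp⟩

lemma unitSum_inr_ne_one (t : ErdosValues) : (t : ℝ) / (1 + t) ≠ 1 := by
  have := nonneg t.2
  rw [Ne, div_eq_one_iff_eq (by positivity)]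
  linarith

lemma continuous_unitSum : Continuous unitSum := by
  refine continuous_const.sumElim (Continuous.subtype_mk ?_ _)
  refine continuous_subtype_val.div (by fun_prop) fun t => ?_
  have := nonneg t.2
  positivity

lemma bijective_unitSum : Function.Bijective unitSum := by
  constructor
  · rintro (⟨⟩ | s) (⟨⟩ | t) h
    · rfl
    · exact absurd (congrArg Subtype.val h).symm (unitSum_inr_ne_one t)
    · exact absurd (congrArg Subtype.val h) (unitSum_inr_ne_one s)
    · have h : (s : ℝ) / (1 + s) = t / (1 + t) := congrArg Subtype.val h
      have hs := nonneg s.2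
      have ht := nonneg t.2
      rw [div_eq_div_iff (by positivity) (by positivity)] at h
      exact congrArg Sum.inr (Subtype.ext (by linarith))
  · rintro ⟨t, rfl | ⟨m, rfl⟩⟩
    · exact ⟨Sum.inr ⟨0, zero_mem⟩, Subtype.ext (by simp [unitSum])⟩
    · rcases m with _ | m
      · exact ⟨Sum.inl (), Subtype.ext (by simp [unitSum])⟩
      · refine ⟨Sum.inr ⟨_, inv_mem m⟩, Subtype.ext ?_⟩
        simp only [unitSum, Sum.elim_inr]
        push_cast
        field_simp

/-- `ErdosValues` is homeomorphic to itself with an isolated point adjoined. -/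
def unitSumHomeomorph : (Unit ⊕ ErdosValues) ≃ₜ ErdosValues :=
  Continuous.homeoOfEquivCompactToT2 (f := Equiv.ofBijective _ bijective_unitSum)
    continuous_unitSum

end ErdosValues

namespace Ec

lemma coord_mem (x : Ec) (n : ℕ) : x.1 n ∈ ErdosValues := x.2 n

lemma coord_nonneg (x : Ec) (n : ℕ) : 0 ≤ x.1 n := ErdosValues.nonneg (coord_mem x n)

instance : Zero Ec := ⟨⟨0, fun _ => ErdosValues.zero_mem⟩⟩

lemma continuous_coord (n : ℕ) : Continuous fun x : Ec => x.1 n :=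
  (EllTwo.continuous_coord n).comp continuous_subtype_val

lemma isClosed_erdosSet : IsClosed ErdosSet := by
  have : ErdosSet = ⋂ n, (fun x : EllTwo => x n) ⁻¹' ErdosValues := by
    ext x
    simp only [Set.mem_iInter]
    rfl
  rw [this]
  exact isClosed_iInter fun n =>
    ErdosValues.isCompact.isClosed.preimage (EllTwo.continuous_coord n)

instance : CompleteSpace Ec := isClosed_erdosSet.completeSpace_coe

/-- The point of `Ec` obtained by replacing one coordinate. -/
def update (x : Ec) (k : ℕ) (v : ErdosValues) : Ec :=
  ⟨x.1 + lp.single 2 k ((v : ℝ) - x.1 k), fun n => by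
    change _ ∈ ErdosValues
    rcases eq_or_ne n k with rfl | h
    · simp
    · simpa [h] using coord_mem x n⟩

@[simp] lemma update_self (x : Ec) (k : ℕ) (v : ErdosValues) : (update x k v).1 k = v := by
  simp [update]

lemma update_of_ne (x : Ec) {k n : ℕ} (v : ErdosValues) (h : n ≠ k) :
    (update x k v).1 n = x.1 n := by
  simp [update, h]

lemma dist_update (x : Ec) (k : ℕ) (v : ErdosValues) :
    dist (update x k v) x = |(v : ℝ) - x.1 k| := by
  rw [Subtype.dist_eq, dist_eq_norm, update, add_sub_cancel_left, lp.norm_single (by simp),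
    Real.norm_eq_abs]

/-- A nonempty closed bounded subset of `Ec` has an element that is maximal for the
coordinatewise order. -/
lemma exists_maximal {C : Set Ec} (hC : IsClosed C) (hne : C.Nonempty) {R : ℝ}
    (hR : ∀ x ∈ C, ‖x.1‖ ≤ R) :
    ∃ y ∈ C, ∀ z ∈ C, (∀ n, y.1 n ≤ z.1 n) → z = y := by
  have step (n : ℕ) (y : C) : ∃ z : C, (∀ k, y.1.1 k ≤ z.1.1 k) ∧
      ∀ w : C, (∀ k, y.1.1 k ≤ w.1.1 k) → ‖w.1.1‖ ≤ ‖z.1.1‖ + 1 / (n + 1) := by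
    let A : Set ℝ := {r | ∃ w : C, (∀ k, y.1.1 k ≤ w.1.1 k) ∧ ‖w.1.1‖ = r}
    have hA : BddAbove A := ⟨R, by rintro _ ⟨w, -, rfl⟩; exact hR _ w.2⟩
    have hAne : A.Nonempty := ⟨_, y, fun _ => le_rfl, rfl⟩
    have hlt : sSup A - 1 / (n + 1) < sSup A := sub_lt_self _ (by positivity)
    obtain ⟨_, ⟨z, hz, rfl⟩, hlt⟩ := exists_lt_of_lt_csSup hAne hlt
    exact ⟨z, hz, fun w hw => by linarith [le_csSup hA ⟨w, hw, rfl⟩]⟩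
  choose next hnext hsup using step
  let u : ℕ → C := fun n => Nat.rec ⟨hne.some, hne.some_mem⟩ next n
  have hu (n : ℕ) : u (n + 1) = next n (u n) := rfl
  have hmono (k : ℕ) : Monotone fun n => (u n).1.1 k :=
    monotone_nat_of_le_succ fun n => by rw [hu]; exact hnext n (u n) k
  have hnorm : Monotone fun n => ‖(u n).1.1‖ := fun m n h =>
    EllTwo.norm_le_norm (coord_nonneg _) fun k => hmono k h
  have hbdd : BddAbove (Set.range fun n => ‖(u n).1.1‖) :=
    ⟨R, by rintro _ ⟨n, rfl⟩; exact hR _ (u n).2⟩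
  have hlim := tendsto_atTop_ciSup hnorm hbdd
  have hcauchy : CauchySeq fun n => (u n).1 := by
    rw [Metric.cauchySeq_iff']
    intro ε hε
    obtain ⟨N, hN⟩ := Metric.cauchySeq_iff'.1 (hlim.pow 2).cauchySeq (ε ^ 2) (by positivity)
    refine ⟨N, fun n hn => lt_of_pow_lt_pow_left₀ 2 hε.le ?_⟩
    rw [Subtype.dist_eq, dist_eq_norm]
    refine (EllTwo.norm_sub_sq_le (coord_nonneg _) fun k => hmono k hn).trans_lt ?_
    exact (le_abs_self _).trans_lt (hN n hn)
  obtain ⟨y, hy⟩ := cauchySeq_tendsto_of_complete hcauchy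
  have hyC : y ∈ C := hC.mem_of_tendsto hy (Eventually.of_forall fun n => (u n).2)
  have huy (n k : ℕ) : (u n).1.1 k ≤ y.1 k :=
    (hmono k).ge_of_tendsto (((continuous_coord k).tendsto y).comp hy) n
  refine ⟨y, hyC, fun z hz hyz => ?_⟩
  have hle : ‖z.1‖ ≤ ‖y.1‖ := by
    refine le_of_tendsto_of_tendsto' tendsto_const_nhds
      (by simpa using (tendsto_one_div_add_atTop_nhds_zero_nat (𝕜 := ℝ)).const_add ‖y.1‖)
      fun n => ?_
    refine (hsup n (u n) ⟨z, hz⟩ fun k => (huy n k).trans (hyz k)).trans ?_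
    rw [← hu, one_div]
    gcongr
    exact EllTwo.norm_le_norm (coord_nonneg _) (huy (n + 1))
  have hsub := EllTwo.norm_sub_sq_le (coord_nonneg y) hyz
  have : ‖z.1 - y.1‖ ^ 2 = 0 := by nlinarith [sq_nonneg ‖z.1 - y.1‖, norm_nonneg z.1]
  exact Subtype.ext (sub_eq_zero.1 (norm_eq_zero.1 (pow_eq_zero_iff two_ne_zero |>.1 this)))

/-- Nonempty clopen subsets of `Ec` are unbounded. -/
lemma eq_empty_of_isClopen_of_bounded {C : Set Ec} (hC : IsClopen C) {R : ℝ}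
    (hR : ∀ x ∈ C, ‖x.1‖ ≤ R) : C = ∅ := by
  by_contra hne
  obtain ⟨y, hyC, hmax⟩ := exists_maximal hC.1 (Set.nonempty_iff_ne_empty.2 hne) hR
  obtain ⟨ε, hε, hball⟩ := Metric.isOpen_iff.1 hC.2 y hyC
  obtain ⟨k, hk⟩ := ((EllTwo.tendsto_coord y.1).eventually_lt_const
    (lt_min hε one_pos)).exists
  obtain ⟨v, hv, hlt, hvε⟩ := ErdosValues.exists_gt (coord_mem y k)
    (hk.trans_le (min_le_left _ _)) (hk.trans_le (min_le_right _ _))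
  have hmem : update y k ⟨v, hv⟩ ∈ C := by
    apply hball
    rw [Metric.mem_ball, dist_update, abs_of_pos (sub_pos.2 hlt)]
    exact hvε
  have heq := hmax _ hmem fun n => by
    rcases eq_or_ne n k with rfl | h
    · rw [update_self]; exact hlt.le
    · rw [update_of_ne _ _ h]
  have := congrArg (fun x : Ec => x.1 k) heq
  simp only [update_self] at this
  exact hlt.ne' this

/-- The points of `Ec` supported on a set of indices. -/
def supportedOn (I : Set ℕ) : Set Ec := {x | ∀ k ∉ I, x.1 k = 0}

lemma zero_mem_supportedOn (I : Set ℕ) : 0 ∈ supportedOn I := fun _ _ => rfl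

lemma isClosed_supportedOn (I : Set ℕ) : IsClosed (supportedOn I) := by
  have : supportedOn I = ⋂ k ∈ Iᶜ, {x : Ec | x.1 k = 0} := by
    ext x
    simp [supportedOn]
  rw [this]
  exact isClosed_biInter fun k _ => isClosed_eq (continuous_coord k) continuous_const

/-- The subspace of points of `Ec` supported on the range of an injection is a copy of `Ec`. -/
def supportedOnRangeHomeomorph (e : ℕ → ℕ) (he : Function.Injective e) :
    supportedOn (Set.range e) ≃ₜ Ec where
  toFun x := ⟨EllTwo.reindex e he x.1.1, fun n => x.1.2 (e n)⟩
  invFun x := ⟨⟨EllTwo.extendZero e he x.1, fun n => by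
      by_cases hn : n ∈ Set.range e
      · obtain ⟨m, rfl⟩ := hn
        simpa using x.2 m
      · exact Or.inl (EllTwo.extendZero_apply_of_notMem e he _ hn)⟩,
    fun n hn => EllTwo.extendZero_apply_of_notMem e he _ hn⟩
  left_inv x := by
    ext n
    by_cases hn : n ∈ Set.range e
    · obtain ⟨m, rfl⟩ := hn
      simp
    · exact (EllTwo.extendZero_apply_of_notMem e he _ hn).trans (x.2 n hn).symm
  right_inv x := by
    ext n
    simp
  continuous_toFun := ((EllTwo.continuous_reindex e he).comp
    (continuous_subtype_val.comp continuous_subtype_val)).subtype_mk _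
  continuous_invFun := (((EllTwo.continuous_extendZero e he).comp
    continuous_subtype_val).subtype_mk _).subtype_mk _

lemma nonempty_supportedOn_homeomorph {I : Set ℕ} (hI : I.Infinite) :
    Nonempty (supportedOn I ≃ₜ Ec) := by
  have he : Function.Injective (Nat.nth (· ∈ I)) := Nat.nth_injective hI
  have hr : Set.range (Nat.nth (· ∈ I)) = I := Nat.range_nth_of_infinite hI
  rw [← hr]
  exact ⟨supportedOnRangeHomeomorph _ he⟩

/-- Splitting off the first coordinate. -/
def consHomeomorph : ErdosValues × Ec ≃ₜ Ec where
  toFun p := ⟨lp.single 2 0 (p.1 : ℝ) +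
      EllTwo.extendZero Nat.succ Nat.succ_injective p.2.1, fun n => by
    change _ ∈ ErdosValues
    rcases n with _ | n
    · simp [EllTwo.extendZero_apply_of_notMem]
    · simp [coord_mem]⟩
  invFun x := ⟨⟨x.1 0, coord_mem x 0⟩,
    ⟨EllTwo.reindex Nat.succ Nat.succ_injective x.1, fun n => x.2 (n + 1)⟩⟩
  left_inv p := by
    refine Prod.ext (Subtype.ext ?_) (Subtype.ext (lp.ext (funext fun n => ?_)))
    · simp [EllTwo.extendZero_apply_of_notMem]
    · simp
  right_inv x := by
    refine Subtype.ext (lp.ext (funext fun n => ?_))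
    rcases n with _ | n
    · simp [EllTwo.extendZero_apply_of_notMem]
    · simp
  continuous_toFun := by
    refine Continuous.subtype_mk (Continuous.add ?_ ?_) _
    · exact (lp.isometry_single (E := fun _ : ℕ => ℝ) 0).continuous.comp
        (continuous_subtype_val.comp continuous_fst)
    · exact (EllTwo.continuous_extendZero _ _).comp (continuous_subtype_val.comp continuous_snd)
  continuous_invFun := ((continuous_coord 0).subtype_mk _).prodMk
    (((EllTwo.continuous_reindex _ _).comp continuous_subtype_val).subtype_mk _)

/-- Two disjoint copies of `Ec` form a copy of `Ec`. -/
def sumHomeomorph : Ec ⊕ Ec ≃ₜ Ec :=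
  ((Homeomorph.punitProd Ec).symm.sumCongr consHomeomorph.symm).trans <|
    (Homeomorph.sumProdDistrib).symm.trans <|
      (ErdosValues.unitSumHomeomorph.prodCongr (Homeomorph.refl Ec)).trans consHomeomorph

lemma nonempty_finProdHomeomorph (n : ℕ) : Nonempty (Fin (n + 1) × Ec ≃ₜ Ec) := by
  induction n with
  | zero => exact ⟨Homeomorph.uniqueProd (Fin 1) Ec⟩
  | succ n ih =>
    obtain ⟨h⟩ := ih
    exact ⟨((finSumFinEquiv (m := n + 1) (n := 1)).symm.toHomeomorphOfDiscrete.prodCongr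
      (Homeomorph.refl Ec)).trans <| Homeomorph.sumProdDistrib.trans <|
        (h.sumCongr (Homeomorph.uniqueProd _ _)).trans sumHomeomorph⟩

end Ec

/-- All odd indices together with the even indices below `2 * n`. -/
def oddOrBelow (n : ℕ) : Set ℕ := {k | Odd k ∨ k < 2 * n}

lemma oddOrBelow_mono : Monotone oddOrBelow := fun _ _ h _ =>
  Or.imp_right fun hk => hk.trans_le (Nat.mul_le_mul_left 2 h)

lemma oddOrBelow_infinite (n : ℕ) : (oddOrBelow n).Infinite :=
  (Set.infinite_of_injective_forall_mem (f := fun m => 2 * m + 1) (fun a b h => by grind)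
    fun m => Or.inl ⟨m, rfl⟩)

/-- An increasing sequence of closed copies of `Ec` inside `Ec`, each nowhere dense in the next. -/
def erdosLevel (n : ℕ) : Set Ec := Ec.supportedOn (oddOrBelow n)

lemma erdosLevel_mono : Monotone erdosLevel := fun _ _ h _ hx k hk =>
  hx k fun hk' => hk (oddOrBelow_mono h hk')

lemma exists_seq_tendsto_of_mem_erdosLevel {n : ℕ} {x : Ec} (hx : x ∈ erdosLevel n) :
    ∃ u : ℕ → Ec, Tendsto u atTop (𝓝 x) ∧ ∀ m, u m ∈ erdosLevel (n + 1) \ erdosLevel n := by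
  have hn : 2 * n ∉ oddOrBelow n := by simp [oddOrBelow]
  have hn' : 2 * n ∈ oddOrBelow (n + 1) := Or.inr (by lia)
  refine ⟨fun m => x.update (2 * n) ⟨_, ErdosValues.inv_mem m⟩, ?_, fun m => ⟨fun k hk => ?_, ?_⟩⟩
  · rw [tendsto_iff_dist_tendsto_zero]
    refine tendsto_one_div_add_atTop_nhds_zero_nat.congr fun m => ?_
    rw [Ec.dist_update, hx _ hn, sub_zero, abs_of_nonneg (by positivity)]
  · rw [Ec.update_of_ne _ _ (by rintro rfl; exact hk hn')]
    exact erdosLevel_mono n.le_succ hx k hk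
  · intro h
    have := h _ hn
    rw [Ec.update_self] at this
    exact (by positivity : (1 / (m + 1) : ℝ) ≠ 0) this

/-- Countably many copies of `⋃ n, erdosLevel n`, topologized so that the copies with positive
label are clopen and shrink to the point `0` of the copy with label `0`. -/
def ErdosFan : Type := ℕ × (⋃ n, erdosLevel n : Set Ec)

namespace ErdosFan

/-- The label of the copy containing a point. -/
def label (p : ErdosFan) : ℕ := p.1

/-- The point of `Ec` underlying a point. -/
def point (p : ErdosFan) : Ec := p.2.1

@[ext] lemma ext {p q : ErdosFan} (h : p.label = q.label) (h' : p.point = q.point) : p = q :=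
  Prod.ext h (Subtype.ext h')

lemma exists_mem_erdosLevel (p : ErdosFan) : ∃ n, p.point ∈ erdosLevel n :=
  Set.mem_iUnion.1 p.2.2

/-- The point of the fan with a given label and underlying point. -/
def mk (k : ℕ) {x : Ec} {n : ℕ} (hx : x ∈ erdosLevel n) : ErdosFan :=
  (k, ⟨x, Set.mem_iUnion.2 ⟨n, hx⟩⟩)

/-- The map inducing the topology of the fan: the coordinate indexed by the label records the
underlying point, and whether the label is positive. -/
def toProd (p : ErdosFan) (j : ℕ) : Bool × Ec :=
  if j = p.label then (decide (j ≠ 0), p.point) else (false, 0)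

lemma toProd_label (p : ErdosFan) : p.toProd p.label = (decide (p.label ≠ 0), p.point) := by
  simp [toProd]

lemma toProd_of_ne (p : ErdosFan) {j : ℕ} (h : j ≠ p.label) : p.toProd j = (false, 0) := by
  simp [toProd, h]

lemma toProd_fst_eq_true_iff (p : ErdosFan) {j : ℕ} (hj : j ≠ 0) :
    (p.toProd j).1 = true ↔ p.label = j := by
  rcases eq_or_ne j p.label with rfl | h
  · simp [toProd_label, hj]
  · simp [toProd_of_ne p h, h.symm]

lemma toProd_injective : Function.Injective toProd := by
  intro p q h
  have key {p q : ErdosFan} (h : p.toProd = q.toProd) (hp : p.label ≠ 0) : q.label = p.label := by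
    rw [← toProd_fst_eq_true_iff q hp, ← h, toProd_fst_eq_true_iff p hp]
  have hl : p.label = q.label := by
    by_cases hp : p.label = 0
    · by_cases hq : q.label = 0
      · rw [hp, hq]
      · exact key h.symm hq
    · exact (key h hp).symm
  have hpt := congrFun h p.label
  rw [toProd_label, hl, toProd_label] at hpt
  exact ext hl (congrArg Prod.snd hpt)

instance : TopologicalSpace ErdosFan := TopologicalSpace.induced toProd inferInstance

lemma isEmbedding_toProd : IsEmbedding toProd := ⟨⟨rfl⟩, toProd_injective⟩

instance : MetrizableSpace ErdosFan := isEmbedding_toProd.metrizableSpace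

instance : SecondCountableTopology ErdosFan := isEmbedding_toProd.secondCountableTopology

lemma continuous_toProd_apply (j : ℕ) : Continuous fun p : ErdosFan => p.toProd j :=
  (continuous_apply j).comp isEmbedding_toProd.continuous

lemma isClopen_label_eq {k : ℕ} (hk : k ≠ 0) : IsClopen {p : ErdosFan | p.label = k} := by
  have h : {p : ErdosFan | p.label = k} = (fun p => (p.toProd k).1) ⁻¹' {true} := by
    ext p
    exact (toProd_fst_eq_true_iff p hk).symm
  rw [h]
  exact (isClopen_discrete _).preimage (continuous_fst.comp (continuous_toProd_apply k))

lemma tendsto_comap_label (p : ErdosFan) (hl : p.label = 0) (h0 : p.point = 0) :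
    Tendsto id (comap label atTop) (𝓝 p) := by
  rw [isEmbedding_toProd.tendsto_nhds_iff, tendsto_pi_nhds]
  intro j
  have hp : p.toProd j = (false, 0) := by
    rcases eq_or_ne j p.label with rfl | h
    · rw [toProd_label, hl, h0]
      rfl
    · exact toProd_of_ne p h
  rw [hp]
  refine tendsto_const_nhds.congr' ?_
  filter_upwards [tendsto_comap.eventually (eventually_gt_atTop j)] with q hq
  exact (toProd_of_ne q hq.ne).symm

/-- The points of level `n` with label at most `n`. -/
def level (n : ℕ) : Set ErdosFan := {p | p.label ≤ n ∧ p.point ∈ erdosLevel n}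

lemma level_mono : Monotone level := fun _ _ h _ hp => ⟨hp.1.trans h, erdosLevel_mono h hp.2⟩

lemma iUnion_level : ⋃ n, level n = Set.univ := by
  refine Set.eq_univ_of_forall fun p => Set.mem_iUnion.2 ?_
  obtain ⟨n, hn⟩ := p.exists_mem_erdosLevel
  exact ⟨max p.label n, le_max_left _ _, erdosLevel_mono (le_max_right _ _) hn⟩

lemma isClosed_level (n : ℕ) : IsClosed (level n) := by
  have h : level n = (⋂ j, {p : ErdosFan | (p.toProd j).2 ∈ erdosLevel n}) ∩
      ⋂ j, ⋂ (_ : n < j), {p : ErdosFan | p.label = j}ᶜ := by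
    ext p
    simp only [level, Set.mem_inter_iff, Set.mem_iInter, Set.mem_compl_iff, Set.mem_ofPred_eq]
    constructor
    · rintro ⟨hl, hx⟩
      refine ⟨fun j => ?_, fun j hj => (hl.trans_lt hj).ne⟩
      rcases eq_or_ne j p.label with rfl | h
      · rwa [toProd_label]
      · rw [toProd_of_ne p h]
        exact Ec.zero_mem_supportedOn _
    · rintro ⟨hx, hl⟩
      refine ⟨not_lt.1 fun h => hl _ h rfl, ?_⟩
      simpa [toProd_label] using hx p.label
  rw [h]
  refine (isClosed_iInter fun j => ?_).inter
    (isClosed_iInter fun j => isClosed_iInter fun hj => ?_)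
  · exact (Ec.isClosed_supportedOn _).preimage
      (continuous_snd.comp (continuous_toProd_apply j))
  · exact (isClopen_label_eq (Nat.ne_zero_of_lt hj)).compl.1

lemma continuous_label_level (n : ℕ) : Continuous fun p : level n => p.1.label := by
  rw [continuous_discrete_rng]
  intro k
  have hpos {j : ℕ} (hj : j ≠ 0) : IsClopen {p : level n | p.1.label = j} :=
    (isClopen_label_eq hj).preimage continuous_subtype_val
  rcases eq_or_ne k 0 with rfl | hk
  · have h : (fun p : level n => p.1.label) ⁻¹' {0} =
        (⋃ j ∈ Finset.Icc 1 n, {p : level n | p.1.label = j})ᶜ := by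
      ext p
      have := p.2.1
      simp only [Set.mem_preimage, Set.mem_singleton_iff, Set.mem_compl_iff, Set.mem_iUnion,
        Finset.mem_Icc, Set.mem_ofPred_eq, exists_prop, exists_eq_right']
      lia
    rw [h]
    refine (isClosed_biUnion_finset fun j hj => (hpos ?_).1).isOpen_compl
    have := (Finset.mem_Icc.1 hj).1
    lia
  · exact (hpos hk).2

lemma continuous_point_level (n : ℕ) : Continuous fun p : level n => p.1.point := by
  rw [continuous_iff_continuousAt]
  intro p
  have hcont : ContinuousAt (fun q : level n => (q.1.toProd p.1.label).2) p :=
    (continuous_snd.comp ((continuous_toProd_apply _).comp continuous_subtype_val)).continuousAt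
  refine hcont.congr ?_
  filter_upwards [((isOpen_discrete {p.1.label}).preimage (continuous_label_level n)).mem_nhds
    (x := p) rfl]
    with q hq
  have hq : q.1.label = p.1.label := hq
  rw [← hq, toProd_label]

lemma continuous_mk (k n : ℕ) :
    Continuous fun x : erdosLevel n => (mk k x.2 : ErdosFan) := by
  rw [isEmbedding_toProd.continuous_iff, continuous_pi_iff]
  intro j
  rcases eq_or_ne j k with rfl | h
  · exact ((continuous_const (y := decide (j ≠ 0))).prodMk continuous_subtype_val).congr
      fun x => (toProd_label (mk j x.2)).symm
  · exact continuous_const.congr fun x => (toProd_of_ne (mk k x.2) h).symm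

/-- Level `n` of the fan is a finite disjoint union of copies of `erdosLevel n`. -/
def levelHomeomorph (n : ℕ) : level n ≃ₜ Fin (n + 1) × erdosLevel n where
  toFun p := (⟨p.1.label, Nat.lt_succ_of_le p.2.1⟩, ⟨p.1.point, p.2.2⟩)
  invFun q := ⟨mk q.1 q.2.2, Nat.le_of_lt_succ q.1.2, q.2.2⟩
  left_inv _ := rfl
  right_inv _ := rfl
  continuous_toFun := by
    refine Continuous.prodMk ?_ ((continuous_point_level n).subtype_mk _)
    exact ((continuous_of_discreteTopology (f := Fin.ofNat (n + 1))).comp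
      (continuous_label_level n)).congr
        fun p => Fin.ext (Nat.mod_eq_of_lt (Nat.lt_succ_of_le p.2.1))
  continuous_invFun := by
    rw [continuous_prod_of_discrete_left]
    exact fun k => (continuous_mk k n).subtype_mk _

lemma nonempty_level_homeomorph (n : ℕ) : Nonempty (level n ≃ₜ Ec) := by
  obtain ⟨h⟩ := Ec.nonempty_supportedOn_homeomorph (oddOrBelow_infinite n)
  obtain ⟨h'⟩ := Ec.nonempty_finProdHomeomorph n
  exact ⟨(levelHomeomorph n).trans (((Homeomorph.refl _).prodCongr h).trans h')⟩

lemma isNowhereDense_level (n : ℕ) :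
    IsNowhereDense {p : level (n + 1) | (p : ErdosFan) ∈ level n} := by
  have hclosed : IsClosed {p : level (n + 1) | (p : ErdosFan) ∈ level n} :=
    (isClosed_level n).preimage continuous_subtype_val
  rw [hclosed.isNowhereDense_iff, Set.eq_empty_iff_forall_notMem]
  intro p hp
  obtain ⟨u, hu, hmem⟩ := exists_seq_tendsto_of_mem_erdosLevel (interior_subset hp).2
  have hlabel := p.2.1
  let v (m : ℕ) : level (n + 1) := ⟨mk p.1.label (hmem m).1, hlabel, (hmem m).1⟩
  have hv : Tendsto v atTop (𝓝 p) := by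
    rw [tendsto_subtype_rng]
    exact ((continuous_mk p.1.label (n + 1)).tendsto ⟨p.1.point, p.2.2⟩).comp
      (tendsto_subtype_rng (f := fun m => (⟨u m, (hmem m).1⟩ : erdosLevel (n + 1))).2 hu)
  obtain ⟨m, hm⟩ := (hv.eventually (mem_interior_iff_mem_nhds.1 hp)).exists
  exact (hmem m).2 hm.2

lemma not_homeomorphic_rat_prod_Ec : ¬ Nonempty (ErdosFan ≃ₜ (ℚ × Ec)) := by
  rintro ⟨h⟩
  let base : ErdosFan := mk 0 (Ec.zero_mem_supportedOn _ : (0 : Ec) ∈ erdosLevel 0)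
  let R : ℝ := ‖(h base).2.1‖ + 1
  have hnhds : ∀ᶠ p in 𝓝 base, ‖(h p).2.1‖ < R := by
    have hcont : Continuous fun p => ‖(h p).2.1‖ :=
      (continuous_subtype_val.comp (continuous_snd.comp h.continuous)).norm
    exact hcont.continuousAt.eventually_lt_const (lt_add_one _)
  obtain ⟨N, hN⟩ := eventually_atTop.1 (eventually_comap.1
    ((tendsto_comap_label base rfl rfl).eventually hnhds))
  have hclopen := isClopen_label_eq N.succ_ne_zero
  let p : ErdosFan := mk (N + 1) (Ec.zero_mem_supportedOn _ : (0 : Ec) ∈ erdosLevel 0)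
  let C : Set Ec := {x | (h.symm ((h p).1, x)).label = N + 1}
  have hC : IsClopen C := hclopen.preimage
    (h.symm.continuous.comp (continuous_const.prodMk continuous_id))
  have hbdd : ∀ x ∈ C, ‖x.1‖ ≤ R := fun x hx => by
    simpa using (hN (N + 1) N.le_succ _ hx).le
  have hp : (h p).2 ∈ C := by
    change (h.symm (h p)).label = N + 1
    rw [h.symm_apply_apply]
    rfl
  rw [Ec.eq_empty_of_isClopen_of_bounded hC hbdd] at hp
  exact hp

end ErdosFan

/-- There is a separable metrizable space `Y` written as an increasing union
of closed copies `X n` of 𝔈_c, each nowhere dense in the next, with `Y` not homeomorphic to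
ℚ × 𝔈_c. -/
theorem exists_capEc_not_homeomorphic_rat_prod_Ec :
    ∃ (Y : Type) (_ : TopologicalSpace Y) (_ : SeparableSpace Y) (_ : MetrizableSpace Y)
      (X : ℕ → Set Y),
      (∀ n, IsClosed (X n)) ∧
      (∀ n, Nonempty (↥(X n) ≃ₜ Ec)) ∧
      (∀ n, X n ⊆ X (n + 1)) ∧
      (∀ n, IsNowhereDense {y : ↥(X (n + 1)) | (y : Y) ∈ X n}) ∧
      (⋃ n, X n) = Set.univ ∧
      ¬ Nonempty (Y ≃ₜ (ℚ × Ec)) :=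
  ⟨ErdosFan, inferInstance, inferInstance, inferInstance, ErdosFan.level,
    ErdosFan.isClosed_level, ErdosFan.nonempty_level_homeomorph,
    fun n => ErdosFan.level_mono n.le_succ, ErdosFan.isNowhereDense_level,
    ErdosFan.iUnion_level, ErdosFan.not_homeomorphic_rat_prod_Ec⟩
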